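/- The return map of H to S factors as the composition of the return maps of the two twists: for μ-almost every z ∈ S, H_S z = G_S (F_S z). -/

import Mathlib

open MeasureTheory
open scoped NNReal ENNReal

noncomputable section

instance : Fact ((0:ℝ) < 2) := ⟨by norm_num⟩

/-- The torus, as a product of two circles of circumference 2. -/
abbrev 𝕋 : Type := AddCircle (2:ℝ) × AddCircle (2:ℝ)

/-- The unique representative in `[0, 2)` of a point of the circle. -/
def θ (x : AddCircle (2:ℝ)) : ℝ := ((AddCircle.equivIco 2 0) x : ℝ)

def P : Set 𝕋 := {z | θ z.2 ≤ 1}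
def Q : Set 𝕋 := {z | θ z.1 ≤ 1}
def R : Set 𝕋 := P ∪ Q
def S : Set 𝕋 := P ∩ Q

/-- The horizontal twist map. -/
def F (z : 𝕋) : 𝕋 :=
  if θ z.2 ≤ 1 then (z.1 + (((2 * θ z.2 : ℝ) : AddCircle (2:ℝ))), z.2) else z

/-- The vertical twist map. -/
def G (z : 𝕋) : 𝕋 :=
  if θ z.1 ≤ 1 then (z.1, z.2 + (((2 * θ z.1 : ℝ) : AddCircle (2:ℝ)))) else z

/-- The linked-twist map. -/
def H : 𝕋 → 𝕋 := G ∘ F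

/-- The first-return time of `T` to `S`. -/
def rtn (T : 𝕋 → 𝕋) (z : 𝕋) : ℕ := sInf {n : ℕ | 1 ≤ n ∧ T^[n] z ∈ S}

/-- The first-return map of `T` to `S`. -/
def retMap (T : 𝕋 → 𝕋) (z : 𝕋) : 𝕋 := T^[rtn T z] z

/-- The set of points of `S` with return time exactly `n`. -/
def Sn (n : ℕ) : Set 𝕋 := {z | z ∈ S ∧ rtn H z = n}

theorem θ_coe_of_mem {r : ℝ} (h0 : 0 ≤ r) (h2 : r < 2) : θ (r : AddCircle (2:ℝ)) = r := by
  have h := AddCircle.equivIco_coe_of_mem (p := (2:ℝ)) (a := 0) (y := r) ⟨h0, by linarith⟩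
  simp [θ, h]

theorem coe_θ (x : AddCircle (2:ℝ)) : ((θ x : ℝ) : AddCircle (2:ℝ)) = x :=
  AddCircle.coe_equivIco

theorem θ_nonneg (x : AddCircle (2:ℝ)) : 0 ≤ θ x :=
  ((AddCircle.equivIco 2 0) x).2.1

/-- Forward translation by a step of length at most `1` cannot jump over a unit interval. -/
theorem exists_add_mul_sub_two_mul_mem_Icc_of_nonneg {t a : ℝ} (ht : t ∈ Set.Icc (0:ℝ) 1)
    (ha : a ∈ Set.Icc (0:ℝ) 1) :
    ∃ n : ℕ, 1 ≤ n ∧ ∃ k : ℤ, t + n * a - 2 * k ∈ Set.Icc (0:ℝ) 1 := by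
  classical
  obtain ⟨ht0, ht1⟩ := ht
  obtain ⟨ha0, ha1⟩ := ha
  by_cases h1 : t + a ≤ 1
  · exact ⟨1, le_rfl, 0, by constructor <;> push_cast <;> linarith⟩
  have hapos : 0 < a := by linarith
  have hex : ∃ n : ℕ, 2 ≤ t + n * a := by
    obtain ⟨n, hn⟩ := exists_nat_ge (2 / a)
    refine ⟨n, ?_⟩
    rw [div_le_iff₀ hapos] at hn
    linarith
  obtain ⟨n, hn, hmin⟩ : ∃ n : ℕ, 2 ≤ t + n * a ∧ ∀ m < n, ¬ 2 ≤ t + m * a :=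
    ⟨Nat.find hex, Nat.find_spec hex, fun _ => Nat.find_min hex⟩
  cases n with
  | zero => norm_num at hn; linarith
  | succ n =>
    have := hmin n n.lt_succ_self
    refine ⟨n + 1, by omega, 1, ?_⟩
    push_cast at hn ⊢
    constructor <;> linarith

theorem exists_add_mul_sub_two_mul_mem_Icc {t a : ℝ} (ht : t ∈ Set.Icc (0:ℝ) 1)
    (ha : a ∈ Set.Icc (-1:ℝ) 1) :
    ∃ n : ℕ, 1 ≤ n ∧ ∃ k : ℤ, t + n * a - 2 * k ∈ Set.Icc (0:ℝ) 1 := by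
  rcases le_total 0 a with h | h
  · exact exists_add_mul_sub_two_mul_mem_Icc_of_nonneg ht ⟨h, ha.2⟩
  · obtain ⟨n, hn, k, hk0, hk1⟩ := exists_add_mul_sub_two_mul_mem_Icc_of_nonneg
      (t := 1 - t) (a := -a) ⟨by linarith [ht.2], by linarith [ht.1]⟩
      ⟨by linarith, by linarith [ha.1]⟩
    refine ⟨n, hn, -k, ?_⟩
    push_cast
    constructor <;> linarith

/-- Every point of `[0, 1]` returns to `[0, 1]` under every rotation of the circle. -/
theorem exists_θ_add_nsmul_le_one {x : AddCircle (2:ℝ)} (hx : θ x ≤ 1) {s : ℝ} (h0 : 0 ≤ s)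
    (h1 : s ≤ 1) :
    ∃ n : ℕ, 1 ≤ n ∧ θ (x + n • ((2 * s : ℝ) : AddCircle (2:ℝ))) ≤ 1 := by
  obtain ⟨a, j, ha, hs⟩ : ∃ (a : ℝ) (j : ℤ), a ∈ Set.Icc (-1:ℝ) 1 ∧ 2 * s = a + 2 * j := by
    rcases le_total s (1 / 2) with h | h
    · exact ⟨2 * s, 0, ⟨by linarith, by linarith⟩, by simp⟩
    · exact ⟨2 * s - 2, 1, ⟨by linarith, by linarith⟩, by simp⟩
  obtain ⟨n, hn, k, hk0, hk1⟩ := exists_add_mul_sub_two_mul_mem_Icc ⟨θ_nonneg x, hx⟩ ha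
  refine ⟨n, hn, ?_⟩
  have key : x + n • ((2 * s : ℝ) : AddCircle (2:ℝ))
      = ((θ x + n * a - 2 * k : ℝ) : AddCircle (2:ℝ)) := by
    conv_lhs => rw [← coe_θ x]
    rw [← AddCircle.coe_nsmul, ← AddCircle.coe_add, ← sub_eq_zero, ← AddCircle.coe_sub,
      AddCircle.coe_eq_zero_iff]
    refine ⟨n * j + k, ?_⟩
    rw [hs]
    simp only [zsmul_eq_mul, nsmul_eq_mul]
    push_cast
    ring
  rw [key, θ_coe_of_mem hk0 (by linarith)]
  exact hk1

theorem F_iterate {z : 𝕋} (hz : z ∈ P) (n : ℕ) :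
    F^[n] z = (z.1 + n • ((2 * θ z.2 : ℝ) : AddCircle (2:ℝ)), z.2) := by
  have hz' : θ z.2 ≤ 1 := hz
  induction n with
  | zero => simp
  | succ n ih => rw [Function.iterate_succ_apply', ih, F, if_pos hz', succ_nsmul, add_assoc]

theorem G_iterate {z : 𝕋} (hz : z ∈ Q) (n : ℕ) :
    G^[n] z = (z.1, z.2 + n • ((2 * θ z.1 : ℝ) : AddCircle (2:ℝ))) := by
  have hz' : θ z.1 ≤ 1 := hz
  induction n with
  | zero => simp
  | succ n ih => rw [Function.iterate_succ_apply', ih, G, if_pos hz', succ_nsmul, add_assoc]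

theorem F_iterate_mem_P {z : 𝕋} (hz : z ∈ P) (n : ℕ) : F^[n] z ∈ P := by
  rw [F_iterate hz]
  exact hz

theorem G_iterate_mem_Q {z : 𝕋} (hz : z ∈ Q) (n : ℕ) : G^[n] z ∈ Q := by
  rw [G_iterate hz]
  exact hz

theorem F_of_notMem_P {z : 𝕋} (hz : z ∉ P) : F z = z := if_neg hz

theorem G_of_notMem_Q {z : 𝕋} (hz : z ∉ Q) : G z = z := if_neg hz

theorem exists_F_iterate_mem_S {z : 𝕋} (hz : z ∈ S) : ∃ n, 1 ≤ n ∧ F^[n] z ∈ S := by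
  obtain ⟨n, hn, h⟩ := exists_θ_add_nsmul_le_one hz.2 (θ_nonneg z.2) hz.1
  refine ⟨n, hn, F_iterate_mem_P hz.1 n, ?_⟩
  rw [F_iterate hz.1]
  exact h

theorem exists_G_iterate_mem_S {z : 𝕋} (hz : z ∈ S) : ∃ n, 1 ≤ n ∧ G^[n] z ∈ S := by
  obtain ⟨n, hn, h⟩ := exists_θ_add_nsmul_le_one hz.1 (θ_nonneg z.1) hz.2
  refine ⟨n, hn, ?_, G_iterate_mem_Q hz.2 n⟩
  rw [G_iterate hz.2]
  exact h

theorem rtn_spec {T : 𝕋 → 𝕋} {z : 𝕋} (h : ∃ n, 1 ≤ n ∧ T^[n] z ∈ S) :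
    1 ≤ rtn T z ∧ T^[rtn T z] z ∈ S :=
  Nat.sInf_mem (s := {n : ℕ | 1 ≤ n ∧ T^[n] z ∈ S}) h

theorem iterate_notMem_S_of_lt_rtn {T : 𝕋 → 𝕋} {z : 𝕋} {k : ℕ} (hk : 1 ≤ k)
    (hlt : k < rtn T z) : T^[k] z ∉ S :=
  fun h => Nat.notMem_of_lt_sInf hlt ⟨hk, h⟩

theorem rtn_eq {T : 𝕋 → 𝕋} {z : 𝕋} {N : ℕ} (hN : 1 ≤ N) (hS : T^[N] z ∈ S)
    (hmin : ∀ k, 1 ≤ k → k < N → T^[k] z ∉ S) : rtn T z = N := by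
  have hspec := rtn_spec ⟨N, hN, hS⟩
  refine le_antisymm (Nat.sInf_le ⟨hN, hS⟩) (not_lt.1 fun h => ?_)
  exact hmin _ hspec.1 h hspec.2

/-- Before the `F`-return to `S`, the orbits of `F` and `H` agree. -/
theorem H_iterate_eq_F_iterate {z : 𝕋} (hz : z ∈ S) {k : ℕ} (hk : k < rtn F z) :
    H^[k] z = F^[k] z := by
  induction k with
  | zero => rfl
  | succ k ih =>
    rw [Function.iterate_succ_apply', ih (by omega), H, Function.comp_apply,
      ← Function.iterate_succ_apply' F]
    exact G_of_notMem_Q fun hQ =>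
      iterate_notMem_S_of_lt_rtn (by omega) hk ⟨F_iterate_mem_P hz.1 _, hQ⟩

/-- Up to the `G`-return to `S`, the orbits of `G w` under `G` and `H` agree. -/
theorem H_iterate_G_eq_G_iterate {w : 𝕋} (hw : w ∈ S) {j : ℕ} (hj : j < rtn G w) :
    H^[j] (G w) = G^[j + 1] w := by
  induction j with
  | zero => rfl
  | succ j ih =>
    rw [Function.iterate_succ_apply', ih (by omega), H, Function.comp_apply,
      F_of_notMem_P fun hP =>
        iterate_notMem_S_of_lt_rtn (by omega) hj ⟨hP, G_iterate_mem_Q hw.2 _⟩,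
      ← Function.iterate_succ_apply' G]

theorem H_iterate_rtn_F {z : 𝕋} (hz : z ∈ S) : H^[rtn F z] z = G (retMap F z) := by
  have hm := (rtn_spec (exists_F_iterate_mem_S hz)).1
  obtain ⟨m, hm'⟩ : ∃ m, rtn F z = m + 1 := ⟨rtn F z - 1, by omega⟩
  rw [retMap, hm', Function.iterate_succ_apply', H_iterate_eq_F_iterate hz (by omega), H,
    Function.comp_apply, ← Function.iterate_succ_apply' F]

theorem retMap_H_eq {z : 𝕋} (hz : z ∈ S) : retMap H z = retMap G (retMap F z) := by
  obtain ⟨hm, hw⟩ := rtn_spec (exists_F_iterate_mem_S hz)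
  change retMap F z ∈ S at hw
  obtain ⟨hn, hv⟩ := rtn_spec (exists_G_iterate_mem_S hw)
  have hlate : ∀ i < rtn G (retMap F z), H^[i + rtn F z] z = G^[i + 1] (retMap F z) :=
    fun i hi => by
      rw [Function.iterate_add_apply, H_iterate_rtn_F hz, H_iterate_G_eq_G_iterate hw hi]
  have hlast : H^[rtn G (retMap F z) - 1 + rtn F z] z = retMap G (retMap F z) := by
    rw [hlate _ (by omega), Nat.sub_add_cancel hn]
    rfl
  have hrtn : rtn H z = rtn G (retMap F z) - 1 + rtn F z := by
    refine rtn_eq (by omega) (by rw [hlast]; exact hv) fun k hk hlt => ?_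
    rcases lt_or_ge k (rtn F z) with h | h
    · rw [H_iterate_eq_F_iterate hz h]
      exact iterate_notMem_S_of_lt_rtn hk h
    · obtain ⟨i, rfl⟩ := Nat.exists_eq_add_of_le' h
      rw [hlate i (by omega)]
      exact iterate_notMem_S_of_lt_rtn (by omega) (by omega)
  rw [retMap, hrtn, hlast]

theorem measurable_θ : Measurable θ :=
  measurable_subtype_coe.comp (AddCircle.measurableEquivIco 2 0).measurable

theorem measurableSet_S : MeasurableSet S :=
  (measurableSet_le (measurable_θ.comp measurable_snd) measurable_const).inter
    (measurableSet_le (measurable_θ.comp measurable_fst) measurable_const)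

/-- The return map of `H` to `S` factors a.e. as the composition of the return maps of the
two twists: for `μ`-a.e. `z ∈ S`, `H_S z = G_S (F_S z)`. -/
theorem returnMap_comp :
    ∀ᵐ z ∂((volume : Measure 𝕋).restrict S), retMap H z = retMap G (retMap F z) := by
  exact (ae_restrict_iff' measurableSet_S).2 (ae_of_all _ fun _ hz => retMap_H_eq hz)
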